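/- arXiv:1304.6740 — 4 statements merged into one kernel-verified Lean document; each statement's English description precedes it below -/
import Mathlib

section
/- Suppose w is conservative and generic. If an edge uv of G satisfies uv ∈ E(P_u) and uv ∉ E(P_v), then P_u is the path obtained by prepending the edge uv to P_v; that is, P_u starts with the edge uv and its remainder from v onward equals P_v (in particular u ∉ V(P_v)). -/
open SimpleGraph

/-- Weight of a walk: sum of the weights of its edges. -/
noncomputable def walkWeight {V : Type*} {G : SimpleGraph V} (w : Sym2 V → ℝ)
    {x y : V} (p : G.Walk x y) : ℝ :=
  (p.edges.map w).sum

/-- `w` is conservative: every cycle of `G` has nonnegative total weight. -/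
def Conservative {V : Type*} (G : SimpleGraph V) (w : Sym2 V → ℝ) : Prop :=
  ∀ (v : V) (c : G.Walk v v), c.IsCycle → 0 ≤ walkWeight w c

/-- `w` is generic: distinct subsets of `E(G)` have distinct total weights. -/
def Generic {V : Type*} (G : SimpleGraph V) (w : Sym2 V → ℝ) : Prop :=
  ∀ A B : Finset (Sym2 V), (∀ e ∈ A, e ∈ G.edgeSet) → (∀ e ∈ B, e ∈ G.edgeSet) →
    (∑ e ∈ A, w e) = (∑ e ∈ B, w e) → A = B

namespace SimpleGraph.Walk

theorem IsPath.eq_of_mem_edges_cons {V : Type*} {G : SimpleGraph V} {u v t x : V}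
    {h : G.Adj u v} {p : G.Walk v t} (hp : (cons h p).IsPath)
    (hx : s(u, x) ∈ (cons h p).edges) : x = v := by
  rw [edges_cons, List.mem_cons] at hx
  rcases hx with hx | hx
  · exact Sym2.congr_right.mp hx
  · exact absurd (p.fst_mem_support_of_mem_edges hx) ((cons_isPath_iff h p).mp hp).2

theorem IsPath.eq_of_mem_edges_iff {V : Type*} {G : SimpleGraph V} {u t : V}
    {p q : G.Walk u t} (hp : p.IsPath) (hq : q.IsPath)
    (h : ∀ e, e ∈ p.edges ↔ e ∈ q.edges) : p = q := by
  induction p with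
  | nil => exact (isPath_iff_nil.mp hq).eq_nil.symm
  | @cons u v t hv p ih =>
    cases q with
    | nil => exact (isPath_iff_nil.mp hp).eq_nil
    | @cons _ v' _ hv' q =>
      obtain rfl : v = v' := hq.eq_of_mem_edges_cons ((h _).mp (by simp))
      have hp' := (cons_isPath_iff hv p).mp hp
      have hq' := (cons_isPath_iff hv' q).mp hq
      have hup : s(u, v) ∉ p.edges := fun hm => hp'.2 (p.fst_mem_support_of_mem_edges hm)
      have huq : s(u, v) ∉ q.edges := fun hm => hq'.2 (q.fst_mem_support_of_mem_edges hm)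
      rw [ih hp'.1 hq'.1 fun e => ?_]
      have he := h e
      simp only [edges_cons, List.mem_cons] at he
      by_cases hev : e = s(u, v)
      · subst hev
        exact iff_of_false hup huq
      · simpa [hev] using he

end SimpleGraph.Walk

theorem walkWeight_cons {V : Type*} {G : SimpleGraph V} (w : Sym2 V → ℝ) {x y z : V}
    (h : G.Adj x y) (p : G.Walk y z) :
    walkWeight w (Walk.cons h p) = w s(x, y) + walkWeight w p := by
  simp [walkWeight]

theorem walkWeight_append {V : Type*} {G : SimpleGraph V} (w : Sym2 V → ℝ) {x y z : V}
    (p : G.Walk x y) (q : G.Walk y z) :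
    walkWeight w (p.append q) = walkWeight w p + walkWeight w q := by
  simp [walkWeight]

/-- Under a generic weight, trails of equal weight have the same edges. -/
theorem Generic.mem_edges_iff {V : Type*} {G : SimpleGraph V} {w : Sym2 V → ℝ}
    (hgen : Generic G w) {x y x' y' : V} {p : G.Walk x y} {q : G.Walk x' y'}
    (hp : p.IsTrail) (hq : q.IsTrail) (h : walkWeight w p = walkWeight w q) (e : Sym2 V) :
    e ∈ p.edges ↔ e ∈ q.edges := by
  classical
  have key := hgen p.edges.toFinset q.edges.toFinset
    (fun e he => p.edges_subset_edgeSet (List.mem_toFinset.mp he))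
    (fun e he => q.edges_subset_edgeSet (List.mem_toFinset.mp he))
    (by rwa [List.sum_toFinset w hp.edges_nodup, List.sum_toFinset w hq.edges_nodup])
  rw [← List.mem_toFinset, key, List.mem_toFinset]

theorem Conservative.walkWeight_pos {V : Type*} {G : SimpleGraph V} {w : Sym2 V → ℝ}
    (hcons : Conservative G w) (hgen : Generic G w) {x y : V} {h : G.Adj x y}
    {p : G.Walk y x} (hc : (Walk.cons h p).IsCycle) : 0 < walkWeight w (Walk.cons h p) := by
  refine lt_of_le_of_ne (hcons x _ hc) fun h0 => ?_
  have hnil : walkWeight w (Walk.nil : G.Walk x x) = 0 := by simp [walkWeight]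
  have := hgen.mem_edges_iff Walk.IsTrail.nil hc.isTrail (hnil.trans h0) s(x, y)
  simp at this

theorem stmt0 {V : Type*} [Fintype V] [DecidableEq V] (G : SimpleGraph V)
    (hconn : G.Connected) (t : V) (w : Sym2 V → ℝ)
    (hcons : Conservative G w) (hgen : Generic G w)
    (P : ∀ v : V, G.Walk v t) (hPpath : ∀ v, (P v).IsPath)
    (hPmin : ∀ (v : V) (Q : G.Walk v t), Q.IsPath → walkWeight w (P v) ≤ walkWeight w Q)
    (u v : V) (huv : G.Adj u v)
    (h1 : s(u, v) ∈ (P u).edges) (h2 : s(u, v) ∉ (P v).edges) :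
    P u = Walk.cons huv (P v) := by
  have hpu := hPpath u
  have hminu := hPmin u
  generalize P u = p at h1 hpu hminu ⊢
  cases p with
  | nil => simp at h1
  | cons h q =>
    obtain rfl := hpu.eq_of_mem_edges_cons h1
    have hq := (Walk.cons_isPath_iff h q).mp hpu
    have hle := hPmin v q hq.1
    by_cases hu : u ∈ (P v).support
    · have hcyc : (Walk.cons huv ((P v).takeUntil u hu)).IsCycle :=
        (Walk.cons_isCycle_iff _ huv).mpr
          ⟨(hPpath v).takeUntil hu, fun hm => h2 ((P v).edges_takeUntil_subset_edges hu hm)⟩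
      have hpos := hcons.walkWeight_pos hgen hcyc
      have hdrop := hminu _ ((hPpath v).dropUntil hu)
      have hsplit := walkWeight_append w ((P v).takeUntil u hu) ((P v).dropUntil u hu)
      rw [Walk.take_spec] at hsplit
      rw [walkWeight_cons] at hpos hdrop
      linarith
    · have hge := hminu _ ((Walk.cons_isPath_iff huv (P v)).mpr ⟨hPpath v, hu⟩)
      rw [walkWeight_cons, walkWeight_cons] at hge
      have heq : walkWeight w q = walkWeight w (P v) := by linarith
      rw [hq.1.eq_of_mem_edges_iff (hPpath v)
        (hgen.mem_edges_iff hq.1.isTrail (hPpath v).isTrail heq)]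
end

section
/- Suppose w is conservative and generic. Then the edge set {uv ∈ E(G) : uv ∈ E(P_u) Δ E(P_v)} (where Δ denotes symmetric difference) contains no cycle of G; that is, these edges form a forest. -/
open SimpleGraph

/-- In a path from `x`, an edge at `x` is the first edge. -/
theorem exists_eq_cons_of_mem_edges {V : Type*} {G : SimpleGraph V} {x y t : V}
    {p : G.Walk x t} (hp : p.IsPath) (he : s(x, y) ∈ p.edges) :
    ∃ (h : G.Adj x y) (q : G.Walk y t), p = Walk.cons h q := by
  cases p with
  | nil => simp at he
  | @cons _ b _ h q =>
    rw [Walk.cons_isPath_iff] at hp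
    rw [Walk.edges_cons, List.mem_cons] at he
    rcases he with he | he
    · obtain rfl : y = b := Sym2.congr_right.mp he
      exact ⟨h, q, rfl⟩
    · exact absurd (q.fst_mem_support_of_mem_edges he) hp.2

/-- Under generic weights, paths of equal weight have equal length. -/
theorem Generic.length_eq {V : Type*} [DecidableEq V] {G : SimpleGraph V} {w : Sym2 V → ℝ}
    (hgen : Generic G w) {x y x' y' : V} {p : G.Walk x y} {q : G.Walk x' y'}
    (hp : p.IsPath) (hq : q.IsPath) (h : walkWeight w p = walkWeight w q) :
    p.length = q.length := by
  have hpn := hp.isTrail.edges_nodup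
  have hqn := hq.isTrail.edges_nodup
  have := hgen p.edges.toFinset q.edges.toFinset
    (fun e he => p.edges_subset_edgeSet (List.mem_toFinset.mp he))
    (fun e he => q.edges_subset_edgeSet (List.mem_toFinset.mp he))
    (by rw [List.sum_toFinset _ hpn, List.sum_toFinset _ hqn]; exact h)
  rw [← p.length_edges, ← q.length_edges, ← List.toFinset_card_of_nodup hpn,
    ← List.toFinset_card_of_nodup hqn, this]

/-- Under conservative weights, a path from `y` avoiding the edge `xy` yields a path from `x`
that is heavier by at most the weight of `xy`. -/
theorem Conservative.exists_isPath_le {V : Type*} [DecidableEq V] {G : SimpleGraph V}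
    {w : Sym2 V → ℝ} (hcons : Conservative G w) {x y t : V} (h : G.Adj x y)
    {p : G.Walk y t} (hp : p.IsPath) (he : s(x, y) ∉ p.edges) :
    ∃ q : G.Walk x t, q.IsPath ∧ walkWeight w q ≤ w s(x, y) + walkWeight w p := by
  by_cases hx : x ∈ p.support
  · refine ⟨p.dropUntil x hx, hp.dropUntil hx, ?_⟩
    have hc := hcons x (Walk.cons h (p.takeUntil x hx)) <|
      (Walk.cons_isCycle_iff _ h).mpr
        ⟨hp.takeUntil hx, fun h' => he (p.edges_takeUntil_subset_edges hx h')⟩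
    rw [walkWeight_cons] at hc
    have hs := walkWeight_append w (p.takeUntil x hx) (p.dropUntil x hx)
    rw [p.take_spec hx] at hs
    linarith
  · exact ⟨Walk.cons h p, hp.cons hx, (walkWeight_cons w h p).le⟩

theorem stmt1 {V : Type*} [Fintype V] [DecidableEq V] (G : SimpleGraph V)
    (hconn : G.Connected) (t : V) (w : Sym2 V → ℝ)
    (hcons : Conservative G w) (hgen : Generic G w)
    (P : ∀ v : V, G.Walk v t) (hPpath : ∀ v, (P v).IsPath)
    (hPmin : ∀ (v : V) (Q : G.Walk v t), Q.IsPath → walkWeight w (P v) ≤ walkWeight w Q) :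
    ∀ (a : V) (c : G.Walk a a), c.IsCycle →
      ¬ (∀ e ∈ c.edges, ∃ x y : V, e = s(x, y) ∧
            Xor' (e ∈ (P x).edges) (e ∈ (P y).edges)) := by
  have key : ∀ x y : V, s(x, y) ∈ (P x).edges → s(x, y) ∉ (P y).edges →
      (P x).length = (P y).length + 1 ∧ (P x).snd = y := by
    intro x y hx hy
    obtain ⟨h, q, hq⟩ := exists_eq_cons_of_mem_edges (hPpath x) hx
    have hqpath : q.IsPath := (hq ▸ hPpath x).of_cons
    obtain ⟨r, hr, hrw⟩ := hcons.exists_isPath_le h (hPpath y) hy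
    have hxr := hPmin x r hr
    rw [hq, walkWeight_cons] at hxr
    have hlen := hgen.length_eq hqpath (hPpath y)
      (le_antisymm (by linarith) (hPmin y q hqpath))
    rw [hq]
    simp [hlen]
  intro a c hc hall
  obtain ⟨u, hu, hmax⟩ := c.support.toFinset.exists_max_image (fun v => (P v).length)
    ⟨a, by simp⟩
  rw [List.mem_toFinset] at hu
  have hsnd : ∀ z : V, s(u, z) ∈ c.edges → (P u).snd = z := by
    intro z hz
    have hle := hmax z (List.mem_toFinset.mpr (c.snd_mem_support_of_mem_edges hz))
    obtain ⟨x, y, hxy, hxor⟩ := hall _ hz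
    have hxor' : Xor (s(u, z) ∈ (P u).edges) (s(u, z) ∈ (P z).edges) := by
      rcases Sym2.eq_iff.mp hxy with ⟨rfl, rfl⟩ | ⟨rfl, rfl⟩
      · exact hxor
      · exact hxor.symm
    rcases hxor' with ⟨h1, h2⟩ | ⟨h1, h2⟩
    · exact (key u z h1 h2).2
    · rw [Sym2.eq_swap] at h1 h2
      have := (key z u h1 h2).1
      omega
  have hc' := hc.rotate hu
  have hmem : ∀ e, e ∈ (c.rotate u hu).edges → e ∈ c.edges :=
    fun e => (c.rotate_edges u hu).mem_iff.mp
  have hsnd' := hsnd _ (hmem _ (Walk.mk_start_snd_mem_edges hc'.not_nil))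
  have hpen := Walk.mk_penultimate_end_mem_edges hc'.not_nil
  rw [Sym2.eq_swap] at hpen
  exact hc'.snd_ne_penultimate (hsnd'.symm.trans (hsnd _ (hmem _ hpen)))
end

section
/- Suppose w is nonnegative (w(e) ≥ 0 for every edge e) and generic, and let uv ∈ E(G) be an edge with u ≠ v and uv ∉ E(P_u) ∪ E(P_v). Then there exist a vertex c and a (possibly trivial) path R from c to t such that: P_u is a path A_u from u to c followed by R, P_v is a path A_v from v to c followed by R, the vertex sets of A_u and A_v intersect exactly in {c}, R meets A_u and A_v only at c, and E(A_u) ∪ {uv} ∪ E(A_v) is the edge set of a cycle of G. In other words, P_u ∪ P_v ∪ {uv} is a planted cycle: a cycle together with two copies of a path from a vertex c of the cycle to t meeting the cycle only at c. -/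
open SimpleGraph

/-- A path is determined by its endpoints and its set of edges. -/
theorem SimpleGraph.Walk.IsPath.eq_of_mem_edges_iff_s6 {V : Type*} {G : SimpleGraph V} {x y : V}
    {p q : G.Walk x y} (hp : p.IsPath) (hq : q.IsPath)
    (h : ∀ e, e ∈ p.edges ↔ e ∈ q.edges) : p = q := by
  induction p with
  | nil => exact (Walk.isPath_iff_nil.mp hq).eq_nil.symm
  | @cons a b c hab p ih =>
    cases q with
    | nil => simpa using h s(a, b)
    | @cons _ d _ had q =>
      rw [Walk.cons_isPath_iff] at hp hq
      have ha_p : ∀ z, s(a, z) ∉ p.edges := fun z hz =>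
        hp.2 (p.fst_mem_support_of_mem_edges hz)
      have ha_q : ∀ z, s(a, z) ∉ q.edges := fun z hz =>
        hq.2 (q.fst_mem_support_of_mem_edges hz)
      have hbd : b = d := by
        have := (h s(a, b)).mp (by simp)
        rw [Walk.edges_cons, List.mem_cons] at this
        exact Sym2.congr_right.mp (this.resolve_right (ha_q b))
      subst hbd
      congr 1
      refine ih hp.1 hq.1 fun e => ?_
      have he := h e
      simp only [Walk.edges_cons, List.mem_cons] at he
      by_cases hab' : e = s(a, b)
      · subst hab'
        exact iff_of_false (ha_p b) (ha_q b)
      · simpa [hab'] using he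

/-- The two parts of a path split at a vertex meet only at that vertex. -/
theorem SimpleGraph.Walk.IsPath.eq_of_mem_support_of_append {V : Type*} {G : SimpleGraph V}
    {x c y z : V} {p : G.Walk x c} {q : G.Walk c y} (h : (p.append q).IsPath)
    (hp : z ∈ p.support) (hq : z ∈ q.support) : z = c := by
  rw [Walk.isPath_def, Walk.support_append] at h
  rw [← q.cons_tail_support, List.mem_cons] at hq
  exact hq.resolve_right fun hz => List.disjoint_of_nodup_append h hp hz

theorem walkWeight_bypass_le {V : Type*} [DecidableEq V] {G : SimpleGraph V} {w : Sym2 V → ℝ}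
    (hw : ∀ e ∈ G.edgeSet, 0 ≤ w e) {x y : V} (p : G.Walk x y) :
    walkWeight w p.bypass ≤ walkWeight w p := by
  refine List.Sublist.sum_le_sum (p.edges_bypass_sublist_edges.map w) ?_
  simp only [List.mem_map, forall_exists_index, and_imp, forall_apply_eq_imp_iff₂]
  exact fun e he => hw e (p.edges_subset_edgeSet he)

/-- For a generic weight, a path is determined by its endpoints and its weight. -/
theorem Generic.eq_of_walkWeight_eq {V : Type*} [DecidableEq V] {G : SimpleGraph V}
    {w : Sym2 V → ℝ} (hw : Generic G w) {x y : V} {p q : G.Walk x y} (hp : p.IsPath)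
    (hq : q.IsPath) (h : walkWeight w p = walkWeight w q) : p = q := by
  have key : p.edges.toFinset = q.edges.toFinset := by
    refine hw _ _ (fun e he => p.edges_subset_edgeSet (by simpa using he))
      (fun e he => q.edges_subset_edgeSet (by simpa using he)) ?_
    rw [List.sum_toFinset _ hp.isTrail.edges_nodup, List.sum_toFinset _ hq.isTrail.edges_nodup]
    exact h
  exact hp.eq_of_mem_edges_iff_s6 hq fun e => by simpa using congrArg (e ∈ ·) key

/-- The part of a minimum-weight path from one of its vertices on is the minimum-weight path
of that vertex. -/
theorem dropUntil_eq_of_minWeight {V : Type*} [DecidableEq V] {G : SimpleGraph V} {t : V}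
    {w : Sym2 V → ℝ} (hnonneg : ∀ e ∈ G.edgeSet, 0 ≤ w e) (hgen : Generic G w)
    {P : ∀ v : V, G.Walk v t} (hPpath : ∀ v, (P v).IsPath)
    (hPmin : ∀ (v : V) (Q : G.Walk v t), Q.IsPath → walkWeight w (P v) ≤ walkWeight w Q)
    {u c : V} (hc : c ∈ (P u).support) : (P u).dropUntil c hc = P c := by
  refine hgen.eq_of_walkWeight_eq ((hPpath u).dropUntil hc) (hPpath c) (le_antisymm ?_ ?_)
  · have hle := (hPmin u _ (((P u).takeUntil c hc).append (P c)).bypass_isPath).trans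
      (walkWeight_bypass_le hnonneg _)
    have hsplit := walkWeight_append w ((P u).takeUntil c hc) ((P u).dropUntil c hc)
    rw [Walk.take_spec] at hsplit
    rw [walkWeight_append] at hle
    linarith
  · exact hPmin c _ ((hPpath u).dropUntil hc)

theorem stmt6 {V : Type*} [Fintype V] [DecidableEq V] (G : SimpleGraph V)
    (hconn : G.Connected) (t : V) (w : Sym2 V → ℝ)
    (hnonneg : ∀ e ∈ G.edgeSet, 0 ≤ w e) (hgen : Generic G w)
    (P : ∀ v : V, G.Walk v t) (hPpath : ∀ v, (P v).IsPath)
    (hPmin : ∀ (v : V) (Q : G.Walk v t), Q.IsPath → walkWeight w (P v) ≤ walkWeight w Q)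
    (u v : V) (huv : G.Adj u v) (hne : u ≠ v)
    (hu : s(u, v) ∉ (P u).edges) (hv : s(u, v) ∉ (P v).edges) :
    ∃ (c : V) (R : G.Walk c t) (Au : G.Walk u c) (Av : G.Walk v c),
      R.IsPath ∧ Au.IsPath ∧ Av.IsPath ∧
      P u = Au.append R ∧ P v = Av.append R ∧
      ({x | x ∈ Au.support} ∩ {x | x ∈ Av.support} = {c}) ∧
      (∀ x ∈ R.support, x ∈ Au.support → x = c) ∧
      (∀ x ∈ R.support, x ∈ Av.support → x = c) ∧
      ∃ C : G.Walk u u, C.IsCycle ∧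
        {e | e ∈ C.edges} =
          {e | e ∈ Au.edges} ∪ {s(u, v)} ∪ {e | e ∈ Av.edges} := by
  obtain ⟨c, hcv, hcu, hfirst⟩ :=
    (P u).exists_mem_support_forall_mem_support_imp_eq (P v).support.toFinset
      ⟨t, by simp⟩
  replace hcv : c ∈ (P v).support := by simpa using hcv
  have hPu : P u = ((P u).takeUntil c hcu).append (P c) := by
    rw [← dropUntil_eq_of_minWeight hnonneg hgen hPpath hPmin hcu, Walk.take_spec]
  have hPv : P v = ((P v).takeUntil c hcv).append (P c) := by
    rw [← dropUntil_eq_of_minWeight hnonneg hgen hPpath hPmin hcv, Walk.take_spec]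
  have hAu := (hPpath u).takeUntil hcu
  have hAv := (hPpath v).takeUntil hcv
  have hmeet : ∀ x ∈ ((P u).takeUntil c hcu).support,
      x ∈ ((P v).takeUntil c hcv).support → x = c := fun x hx hx' =>
    hfirst x (by simpa using (P v).support_takeUntil_subset_support hcv hx') hx
  have hu' : s(u, v) ∉ ((P u).takeUntil c hcu).edges := fun h =>
    hu ((P u).edges_takeUntil_subset_edges hcu h)
  have hv' : s(u, v) ∉ ((P v).takeUntil c hcv).edges := fun h =>
    hv ((P v).edges_takeUntil_subset_edges hcv h)
  refine ⟨c, P c, (P u).takeUntil c hcu, (P v).takeUntil c hcv, hPpath c, hAu, hAv, hPu, hPv,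
    ?_, ?_, ?_,
    Walk.cons huv (((P v).takeUntil c hcv).append ((P u).takeUntil c hcu).reverse), ?_, ?_⟩
  · ext x
    simp only [Set.mem_inter_iff, Set.mem_ofPred_eq, Set.mem_singleton_iff]
    refine ⟨fun h => hmeet x h.1 h.2, ?_⟩
    rintro rfl
    simp
  · exact fun x hR hA => (hPu ▸ hPpath u).eq_of_mem_support_of_append hA hR
  · exact fun x hR hA => (hPv ▸ hPpath v).eq_of_mem_support_of_append hA hR
  · rw [Walk.cons_isCycle_iff]
    refine ⟨?_, by simp [hu', hv']⟩
    rw [Walk.isPath_def, Walk.support_append, List.nodup_append']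
    have hrev := hAu.reverse.support_nodup
    refine ⟨hAv.support_nodup, hrev.tail, fun x hx hx' => ?_⟩
    obtain rfl := hmeet x (by simpa using List.mem_of_mem_tail hx') hx
    rw [← Walk.cons_tail_support] at hrev
    exact (List.nodup_cons.mp hrev).1 hx'
  · ext e
    simp only [Walk.edges_cons, Walk.edges_append, Walk.edges_reverse, List.mem_cons,
      List.mem_append, List.mem_reverse, Set.mem_ofPred_eq, Set.mem_union, Set.mem_singleton_iff]
    tauto
end

section
/- Suppose w is conservative and generic and t is incident to exactly one edge of G. Let C be a cycle of G, c ∈ V(C) a vertex with c ≠ t, and R a path from c to t with V(R) ∩ V(C) = {c}, such that E* ⊆ E(C), every edge xy of C satisfies ζ(xy) ≤ ζ*, and for every vertex x ∈ V(C) the path P_x consists of one of the two arcs of C from x to c followed by R (so P_c = R, whose first edge is denoted cc'). Then every vertex x ∉ V(C) respects C: either P_x contains no vertex of C, or there exists y ∈ V(C) such that E(P_x) ∩ (γ(C) ∪ {cc'}) = E(P_y) ∩ (γ(C) ∪ {cc'}), where γ(C) denotes the set of edges of G with both endpoints in V(C). -/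
open SimpleGraph

/-- `ζ(uv)`: `w(P_u) + w(P_v) + w(uv)` if `uv ∉ E(P_u) ∩ E(P_v)`, and
`w(P_u) + w(P_v) − w(uv)` if `uv ∈ E(P_u) ∩ E(P_v)`. -/
noncomputable def zeta {V : Type*} [DecidableEq V] {G : SimpleGraph V} {t : V}
    (w : Sym2 V → ℝ) (P : ∀ v : V, G.Walk v t) (u v : V) : ℝ :=
  if s(u, v) ∈ (P u).edges ∧ s(u, v) ∈ (P v).edges then
    walkWeight w (P u) + walkWeight w (P v) - w s(u, v)
  else
    walkWeight w (P u) + walkWeight w (P v) + w s(u, v)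

/-- `uv ∉ E(P_u) Δ E(P_v)`. -/
def NotInSymmDiff {V : Type*} {G : SimpleGraph V} {t : V}
    (P : ∀ v : V, G.Walk v t) (u v : V) : Prop :=
  s(u, v) ∈ (P u).edges ↔ s(u, v) ∈ (P v).edges

/-- `ζ* = min { ζ(uv) : uv ∈ E(G), uv ∉ E(P_u) Δ E(P_v) }`. -/
noncomputable def zetaStar {V : Type*} [DecidableEq V] (G : SimpleGraph V) (t : V)
    (w : Sym2 V → ℝ) (P : ∀ v : V, G.Walk v t) : ℝ :=
  sInf {z : ℝ | ∃ u v : V, G.Adj u v ∧ NotInSymmDiff P u v ∧ z = zeta w P u v}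

/-- `E*`: the set of edges attaining the minimum `ζ*`. -/
def EStar {V : Type*} [DecidableEq V] (G : SimpleGraph V) (t : V)
    (w : Sym2 V → ℝ) (P : ∀ v : V, G.Walk v t) : Set (Sym2 V) :=
  {e | ∃ u v : V, e = s(u, v) ∧ G.Adj u v ∧ NotInSymmDiff P u v ∧
        zeta w P u v = zetaStar G t w P}

section Walks

variable {V : Type*} {G : SimpleGraph V}

/-- A walk ending in `S` can be split at its first vertex in `S`. -/
lemma exists_append_first_mem {S : Set V} {x y : V} (p : G.Walk x y) (hy : y ∈ S) :
    ∃ z ∈ S, ∃ (p₀ : G.Walk x z) (p₁ : G.Walk z y),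
      p = p₀.append p₁ ∧ ∀ u ∈ p₀.support, u ∈ S → u = z := by
  induction p with
  | @nil a => exact ⟨a, hy, .nil, .nil, rfl, by simp⟩
  | @cons a b c h p ih =>
    by_cases ha : a ∈ S
    · exact ⟨a, ha, .nil, .cons h p, rfl, by simp⟩
    · obtain ⟨z, hz, p₀, p₁, rfl, hp₀⟩ := ih hy
      refine ⟨z, hz, .cons h p₀, p₁, rfl, fun u hu huS => ?_⟩
      rw [Walk.support_cons, List.mem_cons] at hu
      rcases hu with rfl | hu
      · exact absurd huS ha
      · exact hp₀ u hu huS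

/-- Only one edge of a path contains its starting vertex. -/
lemma SimpleGraph.Walk.IsPath.edge_unique_at_start {x y : V} {p : G.Walk x y} (hp : p.IsPath)
    {e f : Sym2 V} (he : e ∈ p.edges) (hf : f ∈ p.edges) (hxe : x ∈ e) (hxf : x ∈ f) :
    e = f := by
  cases p with
  | nil => simp at he
  | @cons _ b _ h p =>
    rw [Walk.cons_isPath_iff] at hp
    have key : ∀ g ∈ (Walk.cons h p).edges, x ∈ g → g = s(x, b) := by
      intro g hg hxg
      rw [Walk.edges_cons, List.mem_cons] at hg
      rcases hg with rfl | hg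
      · rfl
      · exact absurd (Walk.mem_support_of_mem_edges hg hxg) hp.2
    rw [key e he hxe, key f hf hxf]

lemma exists_mem_edges_of_mem_support {x y z : V} (p : G.Walk x y) (hz : z ∈ p.support)
    (hne : z ≠ x) : ∃ e ∈ p.edges, z ∈ e := by
  induction p with
  | nil => simp at hz; exact absurd hz hne
  | @cons a b c h p ih =>
    rw [Walk.support_cons, List.mem_cons] at hz
    rcases hz with hz | hz
    · exact absurd hz hne
    · by_cases hb : z = b
      · exact ⟨s(a, b), by simp, by simp [hb]⟩
      · obtain ⟨e, he, hze⟩ := ih hz hb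
        exact ⟨e, by simp [he], hze⟩

end Walks

section Joins

open Finset

variable {V : Type*} [DecidableEq V] {G : SimpleGraph V}

/-- The set of odd-degree vertices of an edge set, as a vector over `ZMod 2`. -/
def oddBoundary (F : Finset (Sym2 V)) (v : V) : ZMod 2 :=
  ∑ e ∈ F, if v ∈ e then 1 else 0

/-- Membership of `v` in `{x} Δ {y}`, as an element of `ZMod 2`. -/
def endpoints (x y v : V) : ZMod 2 :=
  (if v = x then 1 else 0) + (if v = y then 1 else 0)

lemma sum_symmDiff_eq {α M : Type*} [DecidableEq α] [AddCommGroup M] (f : α → M)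
    (A B : Finset α) :
    ∑ e ∈ symmDiff A B, f e = ∑ e ∈ B, f e + ∑ e ∈ A, if e ∈ B then -f e else f e := by
  have h1 : ∑ e ∈ symmDiff A B, f e = ∑ e ∈ A \ B, f e + ∑ e ∈ B \ A, f e := by
    rw [← sum_union disjoint_sdiff_sdiff]; rfl
  have h2 := sum_inter_add_sum_sdiff B A f
  have h3 := sum_ite (s := A) (p := fun e => e ∈ B) (fun e => -f e) f
  rw [h1, h3, ← h2, filter_mem_eq_inter, filter_notMem_eq_sdiff, sum_neg_distrib,
    inter_comm A B]
  abel

lemma oddBoundary_symmDiff (A B : Finset (Sym2 V)) (v : V) :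
    oddBoundary (symmDiff A B) v = oddBoundary A v + oddBoundary B v := by
  unfold oddBoundary
  rw [sum_symmDiff_eq, add_comm]
  congr 1
  refine sum_congr rfl fun e _ => ?_
  split_ifs <;> decide

lemma sum_map_mem_edges {x y : V} (p : G.Walk x y) (v : V) :
    (p.edges.map fun e => if v ∈ e then (1 : ZMod 2) else 0).sum = endpoints x y v := by
  induction p with
  | nil =>
    simp only [endpoints, Walk.edges_nil, List.map_nil, List.sum_nil]
    split_ifs <;> decide
  | @cons a b c h p ih =>
    have hab := h.ne
    rw [Walk.edges_cons, List.map_cons, List.sum_cons, ih]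
    simp only [endpoints, Sym2.mem_iff]
    by_cases h1 : v = a
    · have h2 : v ≠ b := h1 ▸ hab
      simp [h1, hab]
    · by_cases h2 : v = b
      · subst h2
        simp only [h1, false_or, if_true, if_false]
        split_ifs <;> decide
      · simp [h1, h2]

lemma sum_edges_toFinset {M : Type*} [AddCommMonoid M] (f : Sym2 V → M) {x y : V}
    {p : G.Walk x y} (hp : p.IsTrail) :
    ∑ e ∈ p.edges.toFinset, f e = (p.edges.map f).sum :=
  List.sum_toFinset f hp.edges_nodup

lemma oddBoundary_edges {x y : V} {p : G.Walk x y} (hp : p.IsTrail) (v : V) :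
    oddBoundary p.edges.toFinset v = endpoints x y v := by
  unfold oddBoundary
  rw [sum_edges_toFinset _ hp, sum_map_mem_edges]

lemma endpoints_add_swap (x y v : V) : endpoints x y v + endpoints x y v = 0 := by
  unfold endpoints
  split_ifs <;> decide

lemma endpoints_add (x y z v : V) :
    endpoints x y v + endpoints y z v = endpoints x z v := by
  unfold endpoints
  split_ifs <;> decide

lemma endpoints_comm (x y v : V) : endpoints x y v = endpoints y x v :=
  add_comm _ _

/-- An edge set with odd-degree vertices `x` and `y` contains an `x`–`y` path. -/
lemma exists_path_of_oddBoundary [Fintype V] {F : Finset (Sym2 V)}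
    (hF : ∀ e ∈ F, e ∈ G.edgeSet) {x y : V}
    (hb : ∀ v, oddBoundary F v = endpoints x y v) :
    ∃ p : G.Walk x y, p.IsPath ∧ p.edges.toFinset ⊆ F := by
  classical
  let H := SimpleGraph.fromEdgeSet (F : Set (Sym2 V))
  have hHG : H ≤ G := by
    intro a b hab
    exact hF _ ((SimpleGraph.fromEdgeSet_adj _).1 hab).1
  have hreach : H.Reachable x y := by
    by_contra hxy
    let S : Finset V := univ.filter fun v => H.Reachable x v
    have h1 : ∑ v ∈ S, oddBoundary F v = 1 := by
      simp only [hb, endpoints, sum_add_distrib, sum_ite_eq']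
      simp [S, hxy]
    have h2 : ∑ v ∈ S, oddBoundary F v = 0 := by
      unfold oddBoundary
      rw [sum_comm]
      refine sum_eq_zero fun e he => ?_
      induction e with
      | h a b =>
        have hadj : G.Adj a b := hF _ he
        have hH : H.Adj a b := (SimpleGraph.fromEdgeSet_adj _).2 ⟨he, hadj.ne⟩
        have hS : H.Reachable x a ↔ H.Reachable x b :=
          ⟨fun h => h.trans hH.reachable, fun h => h.trans hH.symm.reachable⟩
        have h3 : ∀ v, (if v ∈ s(a, b) then (1 : ZMod 2) else 0) = endpoints a b v := by
          intro v
          have := hadj.ne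
          simp only [endpoints, Sym2.mem_iff]
          by_cases h1 : v = a
          · subst h1; simp [this]
          · simp [h1]
        simp only [h3, endpoints, sum_add_distrib, sum_ite_eq']
        simp only [S, mem_filter, mem_univ, true_and, hS]
        split_ifs <;> decide
    rw [h1] at h2
    exact absurd h2 (by decide)
  obtain ⟨p, hp⟩ := hreach.exists_isPath
  refine ⟨p.mapLe hHG, (Walk.isPath_mapLe hHG).2 hp, fun e he => ?_⟩
  rw [List.mem_toFinset, Walk.edges_mapLe_eq_edges] at he
  have := p.edges_subset_edgeSet he
  rw [SimpleGraph.edgeSet_fromEdgeSet] at this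
  exact this.1

lemma oddBoundary_sdiff {A B : Finset (Sym2 V)} (h : B ⊆ A) (v : V) :
    oddBoundary (A \ B) v = oddBoundary A v + oddBoundary B v := by
  rw [← oddBoundary_symmDiff, symmDiff_def, sup_eq_union,
    sdiff_eq_empty_iff_subset.2 h, union_empty]

/-- Under a conservative weighting, edge sets with all degrees even have nonnegative weight. -/
lemma Conservative.sum_nonneg_of_even [Fintype V] {w : Sym2 V → ℝ} (hcons : Conservative G w) :
    ∀ F : Finset (Sym2 V), (∀ e ∈ F, e ∈ G.edgeSet) → (∀ v, oddBoundary F v = 0) →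
      0 ≤ ∑ e ∈ F, w e := by
  intro F
  induction F using Finset.strongInduction with
  | H F ih =>
    intro hF hb
    rcases F.eq_empty_or_nonempty with rfl | ⟨e, he⟩
    · simp
    induction e with
    | h a b =>
      have hadj : G.Adj a b := hF _ he
      have hone : ∀ v, oddBoundary {s(a, b)} v = endpoints b a v := by
        intro v
        have := oddBoundary_edges (p := hadj.toWalk) (Walk.IsPath.of_adj hadj).isTrail v
        rw [endpoints_comm b a, ← this]
        simp [SimpleGraph.Adj.toWalk]
      have hb' : ∀ v, oddBoundary (F \ {s(a, b)}) v = endpoints b a v := by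
        intro v
        rw [oddBoundary_sdiff (singleton_subset_iff.2 he), hb, hone, zero_add]
      obtain ⟨p, hp, hpF⟩ :=
        exists_path_of_oddBoundary (fun e h => hF e (mem_sdiff.1 h).1) hb'
      have hnot : s(a, b) ∉ p.edges := fun h => by
        simpa using hpF (List.mem_toFinset.2 h)
      have hcyc : (Walk.cons hadj p).IsCycle := (Walk.cons_isCycle_iff p hadj).2 ⟨hp, hnot⟩
      have hsub : (Walk.cons hadj p).edges.toFinset ⊆ F := by
        intro e h
        rw [List.mem_toFinset, Walk.edges_cons, List.mem_cons] at h
        rcases h with rfl | h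
        · exact he
        · exact (mem_sdiff.1 (hpF (List.mem_toFinset.2 h))).1
      have hw : 0 ≤ ∑ e ∈ (Walk.cons hadj p).edges.toFinset, w e := by
        rw [sum_edges_toFinset _ hcyc.isTrail]
        exact hcons _ _ hcyc
      have hrest : 0 ≤ ∑ e ∈ F \ (Walk.cons hadj p).edges.toFinset, w e := by
        refine ih _ ?_ (fun e h => hF e (mem_sdiff.1 h).1) fun v => ?_
        · exact sdiff_ssubset hsub ⟨s(a, b), by simp⟩
        · rw [oddBoundary_sdiff hsub, hb, oddBoundary_edges hcyc.isTrail]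
          unfold endpoints
          split_ifs <;> decide
      rw [← sum_sdiff hsub]
      exact add_nonneg hrest hw

/-- A minimum-weight path has minimum weight among all edge sets with the same
odd-degree vertices. -/
lemma Conservative.weight_le_of_oddBoundary [Fintype V] {w : Sym2 V → ℝ}
    (hcons : Conservative G w) {x t : V} {p : G.Walk x t} (hp : p.IsPath)
    (hmin : ∀ Q : G.Walk x t, Q.IsPath → walkWeight w p ≤ walkWeight w Q)
    {F : Finset (Sym2 V)} (hF : ∀ e ∈ F, e ∈ G.edgeSet)
    (hb : ∀ v, oddBoundary F v = endpoints x t v) :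
    ∑ e ∈ p.edges.toFinset, w e ≤ ∑ e ∈ F, w e := by
  obtain ⟨q, hq, hqF⟩ := exists_path_of_oddBoundary hF hb
  have h1 := hmin q hq
  have h2 : 0 ≤ ∑ e ∈ F \ q.edges.toFinset, w e := by
    refine hcons.sum_nonneg_of_even _ (fun e h => hF e (mem_sdiff.1 h).1) fun v => ?_
    rw [oddBoundary_sdiff hqF, hb, oddBoundary_edges hq.isTrail, endpoints_add_swap]
  rw [← sum_sdiff hqF, sum_edges_toFinset _ hp.isTrail, sum_edges_toFinset _ hq.isTrail]
  unfold walkWeight at h1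
  linarith

end Joins

section MinimumPaths

open Finset

variable {V : Type*} [Fintype V] [DecidableEq V] {G : SimpleGraph V} {t : V} {w : Sym2 V → ℝ}

/-- For minimum-weight paths `P x` and `P c` to `t`, the set `P x Δ P c` is the edge set of an
`x`–`c` path. If this path reaches `y` after an initial piece disjoint from `P y Δ P c`, then
it continues along `P y Δ P c`. -/
lemma edges_eq_symmDiff_of_split (hcons : Conservative G w) (hgen : Generic G w)
    {P : ∀ v : V, G.Walk v t} (hPpath : ∀ v, (P v).IsPath)
    (hPmin : ∀ (v : V) (Q : G.Walk v t), Q.IsPath → walkWeight w (P v) ≤ walkWeight w Q)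
    (x c : V) :
    ∃ Q : G.Walk x c, Q.IsPath ∧
      Q.edges.toFinset = symmDiff (P x).edges.toFinset (P c).edges.toFinset ∧
      ∀ (y : V) (Q₀ : G.Walk x y) (Q₁ : G.Walk y c), Q = Q₀.append Q₁ →
        Disjoint Q₀.edges.toFinset (symmDiff (P y).edges.toFinset (P c).edges.toFinset) →
        (P x).edges.toFinset = symmDiff Q₀.edges.toFinset (P y).edges.toFinset := by
  set E : V → Finset (Sym2 V) := fun v => (P v).edges.toFinset
  have walkG : ∀ {a b : V} (p : G.Walk a b), ∀ e ∈ p.edges.toFinset, e ∈ G.edgeSet :=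
    fun p e he => p.edges_subset_edgeSet (List.mem_toFinset.1 he)
  have hEG : ∀ v, ∀ e ∈ E v, e ∈ G.edgeSet := fun v => walkG (P v)
  have symmG : ∀ {A B : Finset (Sym2 V)}, (∀ e ∈ A, e ∈ G.edgeSet) →
      (∀ e ∈ B, e ∈ G.edgeSet) → ∀ e ∈ symmDiff A B, e ∈ G.edgeSet := by
    intro A B hA hB e he
    rcases mem_symmDiff.1 he with h | h
    · exact hA e h.1
    · exact hB e h.1
  have hEb : ∀ v u, oddBoundary (E v) u = endpoints v t u :=
    fun v u => oddBoundary_edges (hPpath v).isTrail u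
  have hle : ∀ v (F : Finset (Sym2 V)), (∀ e ∈ F, e ∈ G.edgeSet) →
      (∀ u, oddBoundary F u = endpoints v t u) → ∑ e ∈ E v, w e ≤ ∑ e ∈ F, w e :=
    fun v F hF hb => hcons.weight_le_of_oddBoundary (hPpath v) (hPmin v) hF hb
  have heq : ∀ v (F : Finset (Sym2 V)), (∀ e ∈ F, e ∈ G.edgeSet) →
      (∀ u, oddBoundary F u = endpoints v t u) → ∑ e ∈ F, w e ≤ ∑ e ∈ E v, w e → E v = F :=
    fun v F hF hb h => hgen _ _ (hEG v) hF (le_antisymm (hle v F hF hb) h)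
  set w' : Sym2 V → ℝ := fun e => if e ∈ E c then -w e else w e
  have hsum : ∀ A : Finset (Sym2 V),
      ∑ e ∈ symmDiff A (E c), w e = ∑ e ∈ E c, w e + ∑ e ∈ A, w' e :=
    fun A => sum_symmDiff_eq w A (E c)
  have hcancel : ∀ v, symmDiff (symmDiff (E v) (E c)) (E c) = E v :=
    fun v => symmDiff_symmDiff_cancel_right _ _
  have hEw : ∀ v, ∑ e ∈ E v, w e = ∑ e ∈ E c, w e + ∑ e ∈ symmDiff (E v) (E c), w' e := by
    intro v
    rw [← hsum, hcancel]
  have hJb : ∀ v u, oddBoundary (symmDiff (E v) (E c)) u = endpoints v c u := by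
    intro v u
    rw [oddBoundary_symmDiff, hEb, hEb, endpoints_comm c, endpoints_add]
  have hJG : ∀ v, ∀ e ∈ symmDiff (E v) (E c), e ∈ G.edgeSet :=
    fun v => symmG (hEG v) (hEG c)
  have hback : ∀ v (A : Finset (Sym2 V)), (∀ u, oddBoundary A u = endpoints v c u) →
      ∀ u, oddBoundary (symmDiff A (E c)) u = endpoints v t u := by
    intro v A hA u
    rw [oddBoundary_symmDiff, hA, hEb, endpoints_add]
  obtain ⟨Q, hQ, hQJ⟩ := exists_path_of_oddBoundary (hJG x) (hJb x)
  have hQb := fun u => oddBoundary_edges hQ.isTrail u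
  have hQeq : Q.edges.toFinset = symmDiff (E x) (E c) := by
    have h1 := hle x (symmDiff Q.edges.toFinset (E c)) (symmG (walkG Q) (hEG c)) (hback x _ hQb)
    have h2 := sum_sdiff hQJ (f := w')
    have h3 := heq c (symmDiff (symmDiff (E x) (E c) \ Q.edges.toFinset) (E c))
      (symmG (fun e h => hJG x e (mem_sdiff.1 h).1) (hEG c))
      (by
        intro u
        rw [oddBoundary_symmDiff, oddBoundary_sdiff hQJ, hJb, hQb, endpoints_add_swap, hEb,
          zero_add])
      (by rw [hsum] at h1 ⊢; rw [hEw x] at h1; linarith)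
    have h4 : symmDiff (E x) (E c) \ Q.edges.toFinset = ∅ := by
      simpa using h3.symm
    exact hQJ.antisymm (sdiff_eq_empty_iff_subset.1 h4)
  refine ⟨Q, hQ, hQeq, fun y Q₀ Q₁ hsplit hdisj => ?_⟩
  have hQ₀ : Q₀.IsPath := by rw [hsplit] at hQ; exact hQ.of_append_left
  have hQ₁ : Q₁.IsPath := by rw [hsplit] at hQ; exact hQ.of_append_right
  have hsub : Q₀.edges.toFinset ∪ Q₁.edges.toFinset = Q.edges.toFinset := by
    rw [hsplit, Walk.edges_append, List.toFinset_append]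
  have hd : Disjoint Q₀.edges.toFinset Q₁.edges.toFinset := by
    have := hQ.isTrail.edges_nodup
    rw [hsplit, Walk.edges_append, List.nodup_append'] at this
    rw [Finset.disjoint_left]
    intro e h0 h1
    exact this.2.2 (List.mem_toFinset.1 h0) (List.mem_toFinset.1 h1)
  have h1 := hle y (symmDiff Q₁.edges.toFinset (E c)) (symmG (walkG Q₁) (hEG c))
    (hback y _ fun u => oddBoundary_edges hQ₁.isTrail u)
  rw [hEw y, hsum] at h1
  have h2 := sum_union hd (f := w')
  rw [hsub, hQeq] at h2
  have h3 := sum_union hdisj (f := w')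
  have hunion : Q₀.edges.toFinset ∪ symmDiff (E y) (E c) =
      symmDiff Q₀.edges.toFinset (symmDiff (E y) (E c)) :=
    (Disjoint.symmDiff_eq_sup hdisj).symm
  have h4 := heq x (symmDiff (Q₀.edges.toFinset ∪ symmDiff (E y) (E c)) (E c))
    (by rw [hunion]; exact symmG (symmG (walkG Q₀) (hJG y)) (hEG c))
    (hback x _ fun u => by
      rw [hunion, oddBoundary_symmDiff, hJb, oddBoundary_edges hQ₀.isTrail, endpoints_add])
    (by rw [hsum, hEw x]; linarith)
  rw [hunion, symmDiff_assoc, hcancel] at h4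
  exact h4

end MinimumPaths

theorem stmt11 {V : Type*} [Fintype V] [DecidableEq V] (G : SimpleGraph V)
    (hconn : G.Connected) (t : V) (w : Sym2 V → ℝ)
    (hcons : Conservative G w) (hgen : Generic G w)
    (P : ∀ v : V, G.Walk v t) (hPpath : ∀ v, (P v).IsPath)
    (hPmin : ∀ (v : V) (Q : G.Walk v t), Q.IsPath → walkWeight w (P v) ≤ walkWeight w Q)
    (hdeg : ∃! x : V, G.Adj t x)
    (a : V) (C : G.Walk a a) (hC : C.IsCycle)
    (c : V) (hc : c ∈ C.support) (hct : c ≠ t)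
    (R : G.Walk c t) (hR : R.IsPath)
    (hRC : {x | x ∈ R.support} ∩ {x | x ∈ C.support} = {c})
    (hEstar : ∀ e ∈ EStar G t w P, e ∈ C.edges)
    (hzle : ∀ x y : V, s(x, y) ∈ C.edges → zeta w P x y ≤ zetaStar G t w P)
    (harc : ∀ x ∈ C.support, ∃ A : G.Walk x c, A.IsPath ∧
      (∀ e ∈ A.edges, e ∈ C.edges) ∧ P x = A.append R)
    (c' : V) (hfirst : R.edges.head? = some s(c, c')) :
    ∀ x : V, x ∉ C.support →
      (∀ y ∈ (P x).support, y ∉ C.support) ∨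
      ∃ y ∈ C.support,
        {e | e ∈ (P x).edges} ∩
            ({e : Sym2 V | e ∈ G.edgeSet ∧ ∀ z ∈ e, z ∈ C.support} ∪ {s(c, c')}) =
          {e | e ∈ (P y).edges} ∩
            ({e : Sym2 V | e ∈ G.edgeSet ∧ ∀ z ∈ e, z ∈ C.support} ∪ {s(c, c')}) := by
  intro x hx
  have hRP : P c = R := by
    obtain ⟨A, hA, -, hPA⟩ := harc c hc
    rw [(Walk.isPath_iff_nil.1 hA).eq_nil] at hPA
    simpa using hPA
  have hRc : ∀ z ∈ R.support, z ∈ C.support → z = c := by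
    intro z h1 h2
    have : z ∈ ({x | x ∈ R.support} ∩ {x | x ∈ C.support} : Set V) := ⟨h1, h2⟩
    rw [hRC] at this
    exact this
  have hccR : s(c, c') ∈ R.edges := List.mem_of_mem_head? (by rw [hfirst]; rfl)
  obtain ⟨Q, hQ, hQeq, hQsplit⟩ :=
    edges_eq_symmDiff_of_split hcons hgen hPpath hPmin x c
  obtain ⟨y, hy, Q₀, Q₁, hsplit, hfst⟩ :=
    exists_append_first_mem (S := {z | z ∈ C.support}) Q hc
  have hout : ∀ e ∈ Q₀.edges, ¬ ∀ z ∈ e, z ∈ C.support := by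
    intro e he hall
    induction e with
    | h u v =>
      have hu := hfst u (Walk.fst_mem_support_of_mem_edges _ he) (hall u (by simp))
      have hv := hfst v (Walk.snd_mem_support_of_mem_edges _ he) (hall v (by simp))
      exact (Q₀.adj_of_mem_edges he).ne (hu.trans hv.symm)
  have hx' : (P x).edges.toFinset = symmDiff Q₀.edges.toFinset (P y).edges.toFinset := by
    refine hQsplit y Q₀ Q₁ hsplit ?_
    rw [Finset.disjoint_left]
    intro e he he'
    obtain ⟨A, -, hAC, hPA⟩ := harc y hy
    refine hout e (List.mem_toFinset.1 he) fun z hz => ?_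
    have heA : e ∈ A.edges := by
      rw [hRP, hPA, Walk.edges_append, List.toFinset_append, Finset.mem_symmDiff] at he'
      simp only [Finset.mem_union, List.mem_toFinset] at he'
      tauto
    exact Walk.mem_support_of_mem_edges (hAC e heA) hz
  have hmem : ∀ e, e ∉ Q₀.edges → (e ∈ (P x).edges ↔ e ∈ (P y).edges) := by
    intro e he
    rw [← List.mem_toFinset, hx', Finset.mem_symmDiff, List.mem_toFinset, List.mem_toFinset]
    tauto
  by_cases hcc : s(c, c') ∈ Q₀.edges
  · left
    intro z hz hzC
    have hcc_Q : ∀ e ∈ Q₀.edges, e ∈ Q.edges := by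
      intro e he
      rw [hsplit, Walk.edges_append]
      exact List.mem_append_left _ he
    have hcy : c = y := hfst c (Walk.fst_mem_support_of_mem_edges _ hcc) hc
    subst hcy
    obtain ⟨e, he, hze⟩ := exists_mem_edges_of_mem_support (P x) hz
      (fun h => hx (h ▸ hzC))
    rw [← List.mem_toFinset, hx', Finset.mem_symmDiff, List.mem_toFinset, List.mem_toFinset,
      hRP] at he
    rcases he with ⟨h1, h2⟩ | ⟨h1, h2⟩
    · have hzc : z = c := hfst z (Walk.mem_support_of_mem_edges h1 hze) hzC
      subst hzc
      have := hQ.reverse.edge_unique_at_start (e := e) (f := s(z, c'))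
        (by simpa using hcc_Q _ h1) (by simpa using hcc_Q _ hcc) hze (by simp)
      exact h2 (this ▸ hccR)
    · have hzc : z = c := hRc z (Walk.mem_support_of_mem_edges h1 hze) hzC
      subst hzc
      have := hR.edge_unique_at_start h1 hccR hze (by simp)
      exact h2 (this ▸ hcc)
  · right
    refine ⟨y, hy, ?_⟩
    ext e
    simp only [Set.mem_inter_iff, Set.mem_ofPred_eq, Set.mem_union, Set.mem_singleton_iff]
    refine and_congr_left fun h => hmem e fun heQ => ?_
    rcases h with h | rfl
    · exact hout e heQ h.2
    · exact hcc heQ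
end
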